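/- arXiv:1512.08788 — 9 statements merged into one kernel-verified Lean document; each statement's English description precedes it below -/
import Mathlib

section
/- Let (Ω,ℱ,P) be a probability space, φ:Ω→ℝ measurable with φ>0 P-a.s. and ∫φ dP = 1, and let u:ℝ→ℝ be strictly concave and differentiable. Suppose X*:Ω→ℝ is measurable and there is a constant c>0 such that u'(X*(ω)) = c·φ(ω) for P-a.e. ω. If X:Ω→ℝ is measurable, φ·X and φ·X* are P-integrable with ∫φX dP = ∫φX* dP, u∘X and u∘X* are P-integrable, and ∫u(X) dP = ∫u(X*) dP, then X = X* P-a.s. -/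
open MeasureTheory Real

/-- The graph of a strictly concave function lies strictly below its tangent line, away from the
point of tangency. -/
theorem StrictConcaveOn.sub_lt_mul_sub_of_hasDerivAt {s : Set ℝ} {f : ℝ → ℝ} {f' x y : ℝ}
    (hf : StrictConcaveOn ℝ s f) (hx : x ∈ s) (hy : y ∈ s) (hxy : y ≠ x)
    (hf' : HasDerivAt f f' x) : f y - f x < f' * (y - x) := by
  rcases hxy.lt_or_gt with h | h
  · have hslope := hf.lt_slope_of_hasDerivAt hy hx h hf'
    rw [slope_def_field, lt_div_iff₀ (sub_pos.2 h)] at hslope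
    linarith
  · have hslope := hf.slope_lt_of_hasDerivAt hx hy h hf'
    rwa [slope_def_field, div_lt_iff₀ (sub_pos.2 h)] at hslope

/-- Uniqueness of the maximizer in the expected utility maximization problem for a
strictly concave utility: any budget-feasible claim attaining the same expected
utility as `X* = I(c φ)` coincides with `X*` almost surely. -/
theorem utility_max_uniqueness
    {Ω : Type*} [MeasurableSpace Ω] (P : Measure Ω) [IsProbabilityMeasure P]
    (φ : Ω → ℝ) (hφmeas : Measurable φ) (hφpos : ∀ᵐ ω ∂P, 0 < φ ω)
    (hφint : Integrable φ P) (hφ1 : ∫ ω, φ ω ∂P = 1)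
    (u u' : ℝ → ℝ) (hu : StrictConcaveOn ℝ Set.univ u)
    (hu' : ∀ x : ℝ, HasDerivAt u (u' x) x)
    (Xstar : Ω → ℝ) (hXstar : Measurable Xstar)
    (c : ℝ) (hc : 0 < c)
    (hfoc : ∀ᵐ ω ∂P, u' (Xstar ω) = c * φ ω)
    (X : Ω → ℝ) (hX : Measurable X)
    (hφX : Integrable (fun ω => φ ω * X ω) P)
    (hφXstar : Integrable (fun ω => φ ω * Xstar ω) P)
    (hbudget : ∫ ω, φ ω * X ω ∂P = ∫ ω, φ ω * Xstar ω ∂P)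
    (huX : Integrable (fun ω => u (X ω)) P)
    (huXstar : Integrable (fun ω => u (Xstar ω)) P)
    (heq : ∫ ω, u (X ω) ∂P = ∫ ω, u (Xstar ω) ∂P) :
    X =ᵐ[P] Xstar := by
  have htangent : ∀ᵐ ω ∂P,
      X ω ≠ Xstar ω → u (X ω) - u (Xstar ω) < c * (φ ω * X ω - φ ω * Xstar ω) := by
    filter_upwards [hfoc] with ω hω hne
    have h := hu.sub_lt_mul_sub_of_hasDerivAt (Set.mem_univ _) (Set.mem_univ _) hne
      (hu' (Xstar ω))
    rw [hω] at h
    linarith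
  have hle : (fun ω => u (X ω) - u (Xstar ω)) ≤ᵐ[P]
      fun ω => c * (φ ω * X ω - φ ω * Xstar ω) := by
    filter_upwards [htangent] with ω hω
    by_cases h : X ω = Xstar ω
    · simp [h]
    · exact (hω h).le
  have hint : ∫ ω, (u (X ω) - u (Xstar ω)) ∂P =
      ∫ ω, c * (φ ω * X ω - φ ω * Xstar ω) ∂P := by
    rw [integral_const_mul, integral_sub huX huXstar, integral_sub hφX hφXstar, heq, hbudget]
    simp
  have hae := (integral_eq_iff_of_ae_le (huX.sub huXstar)
    ((hφX.sub hφXstar).const_mul c) hle).1 hint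
  filter_upwards [htangent, hae] with ω hω hωeq
  by_contra hne
  exact (hω hne).ne hωeq
end

section
/- Let (Ω,ℱ,P) be a probability space, φ:Ω→ℝ measurable with φ>0 P-a.s., ∫φ dP = 1, and suppose φ·log φ is P-integrable; set H := ∫ φ log φ dP. Let β>0 and w∈ℝ. Then for every measurable X:Ω→ℝ such that φ·X is P-integrable with ∫ φ X dP = w and e^{−βX} is P-integrable, one has ∫ (1 − e^{−βX}) dP ≤ 1 − e^{−βw − H}. -/
open MeasureTheory Real

/-- Tangent-line bound for `exp`: the Fenchel-type inequality between `exp x` and `y * log y`,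
shifted by an arbitrary constant `c`. -/
lemma exp_mul_tangent_le_exp {y : ℝ} (hy : 0 < y) (x c : ℝ) :
    Real.exp c * ((1 - c) * y + y * x - y * Real.log y) ≤ Real.exp x := by
  have h := Real.add_one_le_exp (x - Real.log y - c)
  have hx : Real.exp x = Real.exp c * y * Real.exp (x - Real.log y - c) := by
    rw [mul_assoc, Real.exp_sub, Real.exp_sub, Real.exp_log hy]
    field_simp
  rw [hx]
  calc _ = Real.exp c * y * (x - Real.log y - c + 1) := by ring
    _ ≤ _ := by gcongr

/-- Optimality for exponential utility: over the budget set `{X : E[φ X] = w}`, the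
expected exponential utility `E[1 - exp(-β X)]` is at most `1 - exp(-β w - H)`,
where `H = E[φ log φ]` is the relative entropy (Example 4.1 of the paper). -/
theorem exp_utility_optimality
    {Ω : Type*} [MeasurableSpace Ω] (P : Measure Ω) [IsProbabilityMeasure P]
    (φ : Ω → ℝ) (hφmeas : Measurable φ) (hφpos : ∀ᵐ ω ∂P, 0 < φ ω)
    (hφint : Integrable φ P) (hφ1 : ∫ ω, φ ω ∂P = 1)
    (hφlog : Integrable (fun ω => φ ω * Real.log (φ ω)) P)
    (H : ℝ) (hH : H = ∫ ω, φ ω * Real.log (φ ω) ∂P)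
    (β : ℝ) (hβ : 0 < β) (w : ℝ)
    (X : Ω → ℝ) (hX : Measurable X)
    (hφX : Integrable (fun ω => φ ω * X ω) P)
    (hbudget : ∫ ω, φ ω * X ω ∂P = w)
    (hexp : Integrable (fun ω => Real.exp (-β * X ω)) P) :
    ∫ ω, (1 - Real.exp (-β * X ω)) ∂P ≤ 1 - Real.exp (-β * w - H) := by
  set c := -β * w - H with hc
  have h1 : Integrable (fun ω => (1 - c) * φ ω) P := hφint.const_mul _
  have h2 : Integrable (fun ω => β * (φ ω * X ω)) P := hφX.const_mul _
  have hint : Integrable (fun ω => (1 - c) * φ ω - β * (φ ω * X ω)) P := h1.sub h2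
  have hle : ∫ ω, Real.exp c * ((1 - c) * φ ω - β * (φ ω * X ω) - φ ω * Real.log (φ ω)) ∂P
      ≤ ∫ ω, Real.exp (-β * X ω) ∂P := by
    refine integral_mono_ae ((hint.sub hφlog).const_mul _) hexp ?_
    filter_upwards [hφpos] with ω hω
    refine le_of_eq_of_le ?_ (exp_mul_tangent_le_exp hω (-β * X ω) c)
    ring
  rw [integral_const_mul, integral_sub hint hφlog, integral_sub h1 h2, integral_const_mul,
    integral_const_mul, hφ1, hbudget, ← hH] at hle
  have hone : (1 - c) * 1 - β * w - H = 1 := by rw [hc]; ring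
  rw [hone, mul_one] at hle
  rw [integral_sub (integrable_const 1) hexp]
  rw [integral_const, probReal_univ, one_smul]
  exact sub_le_sub_left hle 1
end

section
/- Let (Ω,ℱ,P) be a probability space, φ:Ω→ℝ measurable with φ>0 P-a.s. and ∫φ dP = 1, let γ∈(0,1) and w>0, and suppose φ^{−γ/(1−γ)} is P-integrable; set d := ∫ φ^{−γ/(1−γ)} dP. Then for every measurable X:Ω→ℝ with X ≥ 0 P-a.s., φ·X P-integrable, ∫ φ X dP = w, and X^γ P-integrable, one has ∫ X^γ/γ dP ≤ (1/γ)·w^γ·d^{1−γ}. -/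
open MeasureTheory Real

/-- Weighted arithmetic-geometric mean inequality, rescaled by positive constants `a` and `b`. -/
lemma rpow_mul_rpow_le_rescaled {γ : ℝ} (hγ₀ : 0 ≤ γ) (hγ₁ : γ ≤ 1) {a b x y : ℝ}
    (ha : 0 < a) (hb : 0 < b) (hx : 0 ≤ x) (hy : 0 ≤ y) :
    x ^ γ * y ^ (1 - γ) ≤ a ^ γ * b ^ (1 - γ) * (γ * (x / a) + (1 - γ) * (y / b)) := by
  have amgm := Real.geom_mean_le_arith_mean2_weighted hγ₀ (sub_nonneg.2 hγ₁)
    (div_nonneg hx ha.le) (div_nonneg hy hb.le) (by ring)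
  rw [Real.div_rpow hx ha.le, Real.div_rpow hy hb.le, div_mul_div_comm,
    div_le_iff₀ (by positivity)] at amgm
  linarith

/-- Hölder's inequality for the exponents `1 / γ` and `1 / (1 - γ)`, in multiplicative form. -/
lemma integral_rpow_mul_rpow_le {Ω : Type*} [MeasurableSpace Ω] {P : Measure Ω}
    {γ : ℝ} (hγ₀ : 0 ≤ γ) (hγ₁ : γ ≤ 1) {f g : Ω → ℝ}
    (hf : Integrable f P) (hg : Integrable g P)
    (hf₀ : 0 ≤ᵐ[P] f) (hg₀ : 0 ≤ᵐ[P] g)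
    (hf_pos : 0 < ∫ ω, f ω ∂P) (hg_pos : 0 < ∫ ω, g ω ∂P) :
    ∫ ω, f ω ^ γ * g ω ^ (1 - γ) ∂P ≤ (∫ ω, f ω ∂P) ^ γ * (∫ ω, g ω ∂P) ^ (1 - γ) := by
  set a := ∫ ω, f ω ∂P with ha
  set b := ∫ ω, g ω ∂P with hb
  have hfa : Integrable (fun ω => γ * (f ω / a)) P := (hf.div_const a).const_mul γ
  have hgb : Integrable (fun ω => (1 - γ) * (g ω / b)) P := (hg.div_const b).const_mul (1 - γ)
  calc ∫ ω, f ω ^ γ * g ω ^ (1 - γ) ∂P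
      ≤ ∫ ω, a ^ γ * b ^ (1 - γ) * (γ * (f ω / a) + (1 - γ) * (g ω / b)) ∂P := by
        refine integral_mono_of_nonneg ?_ ((hfa.add hgb).const_mul _) ?_
        · filter_upwards [hf₀, hg₀] with ω hfω hgω
          exact mul_nonneg (Real.rpow_nonneg hfω _) (Real.rpow_nonneg hgω _)
        · filter_upwards [hf₀, hg₀] with ω hfω hgω
          exact rpow_mul_rpow_le_rescaled hγ₀ hγ₁ hf_pos hg_pos hfω hgω
    _ = a ^ γ * b ^ (1 - γ) := by
        rw [integral_const_mul, integral_add hfa hgb, integral_const_mul, integral_const_mul,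
          integral_div, integral_div, ← ha, ← hb, div_self hf_pos.ne', div_self hg_pos.ne']
        ring

/-- Optimality for power utility `u(x) = x^γ/γ`, `γ ∈ (0,1)`: over the budget set
`{X ≥ 0 : E[φ X] = w}`, the expected utility `E[X^γ/γ]` is at most
`w^γ d^{1-γ}/γ`, where `d = E[φ^{-γ/(1-γ)}]` (Section 5 of the paper). -/
theorem power_utility_optimality
    {Ω : Type*} [MeasurableSpace Ω] (P : Measure Ω) [IsProbabilityMeasure P]
    (φ : Ω → ℝ) (hφmeas : Measurable φ) (hφpos : ∀ᵐ ω ∂P, 0 < φ ω)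
    (hφint : Integrable φ P) (hφ1 : ∫ ω, φ ω ∂P = 1)
    (γ : ℝ) (hγ : γ ∈ Set.Ioo (0 : ℝ) 1) (w : ℝ) (hw : 0 < w)
    (hmom : Integrable (fun ω => φ ω ^ (-γ / (1 - γ)) : Ω → ℝ) P)
    (d : ℝ) (hd : d = ∫ ω, φ ω ^ (-γ / (1 - γ)) ∂P)
    (X : Ω → ℝ) (hX : Measurable X) (hXpos : ∀ᵐ ω ∂P, 0 ≤ X ω)
    (hφX : Integrable (fun ω => φ ω * X ω) P)
    (hbudget : ∫ ω, φ ω * X ω ∂P = w)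
    (hXγ : Integrable (fun ω => X ω ^ γ : Ω → ℝ) P) :
    ∫ ω, X ω ^ γ / γ ∂P ≤ (1 / γ) * w ^ γ * d ^ (1 - γ) := by
  obtain ⟨hγ₀, hγ₁⟩ := hγ
  have hγ' : 1 - γ ≠ 0 := (sub_pos.2 hγ₁).ne'
  have hd_pos : 0 < ∫ ω, φ ω ^ (-γ / (1 - γ)) ∂P :=
    integral_pos_iff_support_of_nonneg_ae
      (by filter_upwards [hφpos] with ω hφω using Real.rpow_nonneg hφω.le _) hmom |>.2 <| by
    have hsupp : ∀ᵐ ω ∂P, ω ∈ Function.support fun ω => φ ω ^ (-γ / (1 - γ)) := by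
      filter_upwards [hφpos] with ω hφω using (Real.rpow_pos_of_pos hφω _).ne'
    rw [measure_eq_measure_of_null_sdiff (Set.subset_univ _) (by rwa [← Set.compl_eq_univ_sdiff]),
      measure_univ]
    exact one_pos
  have hX_eq : (fun ω => X ω ^ γ) =ᵐ[P]
      fun ω => (φ ω * X ω) ^ γ * (φ ω ^ (-γ / (1 - γ))) ^ (1 - γ) := by
    filter_upwards [hφpos, hXpos] with ω hφω hXω
    rw [← Real.rpow_mul hφω.le, div_mul_cancel₀ _ hγ', Real.mul_rpow hφω.le hXω,
      mul_right_comm, ← Real.rpow_add hφω, add_neg_cancel, Real.rpow_zero, one_mul]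
  have holder := integral_rpow_mul_rpow_le hγ₀.le hγ₁.le hφX hmom
    (by filter_upwards [hφpos, hXpos] with ω hφω hXω using mul_nonneg hφω.le hXω)
    (by filter_upwards [hφpos] with ω hφω using Real.rpow_nonneg hφω.le _)
    (hbudget ▸ hw) hd_pos
  rw [← integral_congr_ae hX_eq, hbudget, ← hd] at holder
  rw [integral_div, div_eq_inv_mul, mul_assoc, one_div]
  gcongr
end

section
/- Let (Ω,ℱ,P) be a probability space, φ:Ω→ℝ measurable with φ>0 P-a.s., ∫φ dP = 1, and log φ P-integrable; let w>0. Then: (a) for every measurable X:Ω→ℝ with X>0 P-a.s., φ·X P-integrable, ∫ φ X dP = w, and log X P-integrable, one has ∫ log X dP ≤ log w − ∫ log φ dP; (b) X* := w/φ satisfies ∫ φ X* dP = w and ∫ log X* dP = log w − ∫ log φ dP. -/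
open MeasureTheory Real

/-- Logarithmic utility maximization over the budget set `{X > 0 : E[φ X] = w}`:
(a) every feasible claim `X` satisfies `E[log X] ≤ log w - E[log φ]`;
(b) the optimal profile `X* = w/φ` is feasible and attains this bound
(Section 5 of the paper). -/
theorem log_utility_optimality
    {Ω : Type*} [MeasurableSpace Ω] (P : Measure Ω) [IsProbabilityMeasure P]
    (φ : Ω → ℝ) (hφmeas : Measurable φ) (hφpos : ∀ᵐ ω ∂P, 0 < φ ω)
    (hφint : Integrable φ P) (hφ1 : ∫ ω, φ ω ∂P = 1)
    (hlogφ : Integrable (fun ω => Real.log (φ ω)) P)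
    (w : ℝ) (hw : 0 < w) :
    (∀ X : Ω → ℝ, Measurable X → (∀ᵐ ω ∂P, 0 < X ω) →
      Integrable (fun ω => φ ω * X ω) P →
      ∫ ω, φ ω * X ω ∂P = w →
      Integrable (fun ω => Real.log (X ω)) P →
      ∫ ω, Real.log (X ω) ∂P ≤ Real.log w - ∫ ω, Real.log (φ ω) ∂P) ∧
    (∫ ω, φ ω * (w / φ ω) ∂P = w ∧
      ∫ ω, Real.log (w / φ ω) ∂P = Real.log w - ∫ ω, Real.log (φ ω) ∂P) := by
  refine ⟨fun X _ hXpos hφX hbudget hlogX => ?_, ?_, ?_⟩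
  · have hbound : ∀ᵐ ω ∂P, log (X ω) + log (φ ω) ≤ log w + (φ ω * X ω / w - 1) := by
      filter_upwards [hφpos, hXpos] with ω hφω hXω
      have h := log_le_sub_one_of_pos (div_pos (mul_pos hφω hXω) hw)
      rw [log_div (mul_pos hφω hXω).ne' hw.ne', log_mul hφω.ne' hXω.ne'] at h
      linarith
    have hdiv : Integrable (fun ω => φ ω * X ω / w) P := hφX.div_const w
    have hsub : Integrable (fun ω => φ ω * X ω / w - 1) P := hdiv.sub (integrable_const 1)
    have hint := integral_mono_ae (hlogX.add hlogφ) ((integrable_const (log w)).add hsub) hbound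
    simp only [Pi.add_apply] at hint
    rw [integral_add hlogX hlogφ, integral_add (integrable_const _) hsub,
      integral_sub hdiv (integrable_const _), integral_div, hbudget, div_self hw.ne'] at hint
    simp only [integral_const, probReal_univ, one_smul, sub_self, add_zero] at hint
    linarith
  · have hcancel : ∀ᵐ ω ∂P, φ ω * (w / φ ω) = w := by
      filter_upwards [hφpos] with ω hφω
      exact mul_div_cancel₀ w hφω.ne'
    rw [integral_congr_ae hcancel]
    simp
  · have hlog : ∀ᵐ ω ∂P, log (w / φ ω) = log w - log (φ ω) := by
      filter_upwards [hφpos] with ω hφω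
      exact log_div hw.ne' hφω.ne'
    rw [integral_congr_ae hlog, integral_sub (integrable_const _) hlogφ]
    simp
end

section
/- Let H ∈ (0,1) and define D(s,t) = (t−s)^{2H} + (t+s)^{2H} − 2^{2H−1}(t^{2H}+s^{2H}) for 0 ≤ s ≤ t. Then there exist constants c₁, c₂ > 0 such that for all 0 ≤ s ≤ t, c₁(t−s)^{2H} ≤ D(s,t) ≤ c₂(t−s)^{2H}. -/
open Real

theorem Real.add_rpow_add_sub_rpow_le {b x y : ℝ} (hb₀ : 0 ≤ b) (hb₁ : b ≤ 1)
    (hy : 0 ≤ y) (hyx : y ≤ x) : (x + y) ^ b + (x - y) ^ b ≤ 2 * x ^ b := by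
  have h := (Real.concaveOn_rpow hb₀ hb₁).2
    (Set.mem_Ici.2 (show 0 ≤ x + y by linarith)) (Set.mem_Ici.2 (show 0 ≤ x - y by linarith))
    (show (0 : ℝ) ≤ 1 / 2 by norm_num) (show (0 : ℝ) ≤ 1 / 2 by norm_num) (by norm_num)
  have hx : (1 / 2 : ℝ) * (x + y) + 1 / 2 * (x - y) = x := by ring
  simp only [smul_eq_mul, hx] at h
  linarith

theorem Real.le_add_rpow_add_sub_rpow {a x y : ℝ} (ha : 1 ≤ a)
    (hy : 0 ≤ y) (hyx : y ≤ x) : 2 * x ^ a ≤ (x + y) ^ a + (x - y) ^ a := by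
  have h := (convexOn_rpow ha).2
    (Set.mem_Ici.2 (show 0 ≤ x + y by linarith)) (Set.mem_Ici.2 (show 0 ≤ x - y by linarith))
    (show (0 : ℝ) ≤ 1 / 2 by norm_num) (show (0 : ℝ) ≤ 1 / 2 by norm_num) (by norm_num)
  have hx : (1 / 2 : ℝ) * (x + y) + 1 / 2 * (x - y) = x := by ring
  simp only [smul_eq_mul, hx] at h
  linarith

theorem Real.antitoneOn_rpow_second_difference {a y : ℝ} (ha₁ : 1 ≤ a) (ha₂ : a ≤ 2)
    (hy : 0 ≤ y) :
    AntitoneOn (fun x : ℝ => (x + y) ^ a + (x - y) ^ a - 2 * x ^ a) (Set.Ici y) := by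
  have hderiv (x : ℝ) : HasDerivAt (fun x : ℝ => (x + y) ^ a + (x - y) ^ a - 2 * x ^ a)
      (a * ((x + y) ^ (a - 1) + (x - y) ^ (a - 1) - 2 * x ^ (a - 1))) x := by
    have h := ((((hasDerivAt_id x).add_const y).rpow_const (p := a) (Or.inr ha₁)).add
      (((hasDerivAt_id x).sub_const y).rpow_const (p := a) (Or.inr ha₁))).sub
      (((hasDerivAt_id x).rpow_const (p := a) (Or.inr ha₁)).const_mul 2)
    exact h.congr_deriv (by simp only [id]; ring)
  refine antitoneOn_of_deriv_nonpos (convex_Ici y)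
    (fun x _ => (hderiv x).continuousAt.continuousWithinAt)
    (fun x _ => (hderiv x).differentiableAt.differentiableWithinAt) fun x hx => ?_
  rw [interior_Ici] at hx
  rw [(hderiv x).deriv]
  have h := Real.add_rpow_add_sub_rpow_le (b := a - 1) (by linarith) (by linarith) hy hx.le
  exact mul_nonpos_of_nonneg_of_nonpos (by linarith) (by linarith)

/-- Condition (A) for subfractional Brownian motion with index `H ∈ (0,1)`
(Example (iii) in Section 3 of the paper): the incremental variance
`D(s,t) = (t-s)^{2H} + (t+s)^{2H} - 2^{2H-1}(t^{2H} + s^{2H})` satisfies the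
two-sided power bound `c₁ (t-s)^{2H} ≤ D(s,t) ≤ c₂ (t-s)^{2H}`. -/
theorem subfBm_incremental_variance_two_sided_bound
    (H : ℝ) (hH : H ∈ Set.Ioo (0 : ℝ) 1) :
    ∃ c₁ c₂ : ℝ, 0 < c₁ ∧ 0 < c₂ ∧
      ∀ s t : ℝ, 0 ≤ s → s ≤ t →
        c₁ * (t - s) ^ (2 * H) ≤
          (t - s) ^ (2 * H) + (t + s) ^ (2 * H)
            - 2 ^ (2 * H - 1) * (t ^ (2 * H) + s ^ (2 * H)) ∧
        (t - s) ^ (2 * H) + (t + s) ^ (2 * H)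
            - 2 ^ (2 * H - 1) * (t ^ (2 * H) + s ^ (2 * H)) ≤
          c₂ * (t - s) ^ (2 * H) := by
  obtain ⟨hH₀, hH₁⟩ := hH
  have hscale (x : ℝ) (hx : 0 ≤ x) :
      (2 * x) ^ (2 * H) = 2 * (2 ^ (2 * H - 1) * x ^ (2 * H)) := by
    rw [mul_rpow zero_le_two hx, rpow_sub_one two_ne_zero]
    ring
  rcases le_total (2 * H) 1 with h | h
  · refine ⟨1, 3 / 2, one_pos, by norm_num, fun s t hs hst => ?_⟩
    have ht : 0 ≤ t := hs.trans hst
    have hmid := Real.add_rpow_add_sub_rpow_le (x := t + s) (y := t - s) (by linarith) h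
      (by linarith) (by linarith)
    have hsub := Real.rpow_add_le_add_rpow (a := 2 * s) (b := t - s) (by linarith)
      (by linarith) (by linarith) h
    have hmono : (t + s) ^ (2 * H) ≤ (2 * t) ^ (2 * H) :=
      rpow_le_rpow (by linarith) (by linarith) (by linarith)
    rw [show t + s + (t - s) = 2 * t by ring, show t + s - (t - s) = 2 * s by ring,
      hscale s hs, hscale t ht] at hmid
    rw [show 2 * s + (t - s) = t + s by ring, hscale s hs] at hsub
    rw [hscale t ht] at hmono
    constructor <;> linarith
  · have hc : (2 : ℝ) ^ (2 * H - 1) < 2 := by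
      simpa using rpow_lt_rpow_of_exponent_lt one_lt_two (show 2 * H - 1 < 1 by linarith)
    refine ⟨2 - 2 ^ (2 * H - 1), 1, by linarith, one_pos, fun s t hs hst => ?_⟩
    have ht : 0 ≤ t := hs.trans hst
    have hmid := Real.le_add_rpow_add_sub_rpow (x := t + s) (y := t - s) h
      (by linarith) (by linarith)
    have hanti := Real.antitoneOn_rpow_second_difference (y := t - s) h (by linarith)
      (by linarith) (Set.mem_Ici.2 le_rfl)
      (Set.mem_Ici.2 (show t - s ≤ t + s by linarith)) (by linarith)
    simp only [sub_self, zero_rpow (show 2 * H ≠ 0 by linarith), ← two_mul (t - s),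
      hscale (t - s) (by linarith)] at hanti
    rw [show t + s + (t - s) = 2 * t by ring, show t + s - (t - s) = 2 * s by ring,
      hscale s hs, hscale t ht] at hmid hanti
    constructor <;> linarith
end

section
/- Let H ∈ (1/2,1) and define C(t,s) = t^{2H}+s^{2H} − ((t+s)^{2H}+|t−s|^{2H})/2 for t,s ≥ 0. Then for all 0 ≤ s₁ ≤ t₁ ≤ s₂ ≤ t₂, one has C(t₁,t₂) − C(t₁,s₂) − C(s₁,t₂) + C(s₁,s₂) ≥ 0. -/
open Real

/-- A concave function has decreasing increments. -/
lemma ConcaveOn.add_le_add_of_shift {s : Set ℝ} {f : ℝ → ℝ} (hf : ConcaveOn ℝ s f) {a b d : ℝ}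
    (ha : a ∈ s) (hbd : b + d ∈ s) (hab : a ≤ b) (hd : 0 ≤ d) :
    f a + f (b + d) ≤ f b + f (a + d) := by
  rcases hd.eq_or_lt with rfl | hd
  · simp [add_comm]
  have hL : 0 < b - a + d := by linarith
  have hsum : d / (b - a + d) + (b - a) / (b - a + d) = 1 := by field_simp; ring
  have hu : 0 ≤ d / (b - a + d) := by positivity
  have hv : 0 ≤ (b - a) / (b - a + d) := div_nonneg (by linarith) hL.le
  have hb := hf.2 ha hbd hu hv hsum
  have had := hf.2 ha hbd hv hu (by rw [add_comm, hsum])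
  simp only [smul_eq_mul] at hb had
  have eb : d / (b - a + d) * a + (b - a) / (b - a + d) * (b + d) = b := by
    field_simp; ring
  have ead : (b - a) / (b - a + d) * a + d / (b - a + d) * (b + d) = a + d := by
    field_simp; ring
  rw [eb] at hb
  rw [ead] at had
  linear_combination hb + had - (f a + f (b + d)) * hsum

lemma hasDerivAt_rpow_add_rpow_sub {p : ℝ} (hp : 1 ≤ p) (x t : ℝ) :
    HasDerivAt (fun t => (x + t) ^ p + (x - t) ^ p)
      (p * ((x + t) ^ (p - 1) - (x - t) ^ (p - 1))) t := by
  have hadd := ((hasDerivAt_id t).const_add x).rpow_const (p := p) (Or.inr hp)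
  have hsub := ((hasDerivAt_id t).const_sub x).rpow_const (p := p) (Or.inr hp)
  refine (hadd.add hsub).congr_deriv ?_
  simp only [id]
  ring

lemma antitoneOn_rpow_add_rpow_sub {p : ℝ} (hp₁ : 1 ≤ p) (hp₂ : p ≤ 2) {x y : ℝ} (hxy : x ≤ y) :
    AntitoneOn (fun t => ((y + t) ^ p + (y - t) ^ p) - ((x + t) ^ p + (x - t) ^ p))
      (Set.Icc 0 x) := by
  have hderiv := fun t => (hasDerivAt_rpow_add_rpow_sub hp₁ y t).sub
    (hasDerivAt_rpow_add_rpow_sub hp₁ x t)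
  refine antitoneOn_of_hasDerivWithinAt_nonpos (convex_Icc 0 x)
    (fun t _ => (hderiv t).continuousAt.continuousWithinAt)
    (fun t _ => (hderiv t).hasDerivWithinAt) fun t ht => ?_
  rw [interior_Icc] at ht
  obtain ⟨ht₀, htx⟩ := ht
  have hconc := (Real.concaveOn_rpow (p := p - 1) (by linarith) (by linarith)).add_le_add_of_shift
    (a := x - t) (b := x + t) (d := y - x) (Set.mem_Ici.2 (by linarith))
    (Set.mem_Ici.2 (by linarith)) (by linarith) (by linarith)
  rw [show x + t + (y - x) = y + t by ring, show x - t + (y - x) = y - t by ring] at hconc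
  rw [← mul_sub]
  exact mul_nonpos_of_nonneg_of_nonpos (by linarith) (by linarith)

/-- Condition (B) for subfractional Brownian motion with index `H > 1/2`
(Example (iii) in Section 3 of the paper): with covariance
`C(t,s) = t^{2H} + s^{2H} - ((t+s)^{2H} + |t-s|^{2H})/2`, increments over disjoint
ordered intervals are positively correlated. -/
theorem subfBm_increments_positively_correlated
    (H : ℝ) (hH : H ∈ Set.Ioo (1 / 2 : ℝ) 1)
    (C : ℝ → ℝ → ℝ)
    (hC : ∀ t s : ℝ, C t s =
      t ^ (2 * H) + s ^ (2 * H) - ((t + s) ^ (2 * H) + |t - s| ^ (2 * H)) / 2)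
    (s₁ t₁ s₂ t₂ : ℝ) (h0 : 0 ≤ s₁) (h1 : s₁ ≤ t₁) (h2 : t₁ ≤ s₂) (h3 : s₂ ≤ t₂) :
    0 ≤ C t₁ t₂ - C t₁ s₂ - C s₁ t₂ + C s₁ s₂ := by
  obtain ⟨hH₁, hH₂⟩ := hH
  have hanti := antitoneOn_rpow_add_rpow_sub (p := 2 * H) (by linarith) (by linarith) h3
    (Set.mem_Icc.2 ⟨h0, h1.trans h2⟩) (Set.mem_Icc.2 ⟨h0.trans h1, h2⟩) h1
  simp only [hC]
  rw [abs_sub_comm t₁ t₂, abs_sub_comm t₁ s₂, abs_sub_comm s₁ t₂, abs_sub_comm s₁ s₂,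
    abs_of_nonneg (by linarith : 0 ≤ t₂ - t₁), abs_of_nonneg (by linarith : 0 ≤ s₂ - t₁),
    abs_of_nonneg (by linarith : 0 ≤ t₂ - s₁), abs_of_nonneg (by linarith : 0 ≤ s₂ - s₁),
    add_comm t₁ t₂, add_comm t₁ s₂, add_comm s₁ t₂, add_comm s₁ s₂]
  linarith
end

section
/- Let H ∈ (0,1) and K ∈ (0,1), and define R(t,s) = 2^{−K}((t^{2H}+s^{2H})^K − |t−s|^{2HK}) for t,s ≥ 0. Then for all 0 ≤ s ≤ t, 2^{−K}(t−s)^{2HK} ≤ R(t,t) + R(s,s) − 2R(t,s) ≤ 2^{1−K}(t−s)^{2HK}. -/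
open Real

/-- A power inequality for a pair of numbers with mean `1` and geometric mean `1 - w`. -/
lemma two_le_rpow_add_rpow_add_rpow {A B w K : ℝ} (hA : 0 ≤ A) (hB : 0 ≤ B) (hAB : A + B = 2)
    (hw : 0 ≤ w) (hw1 : w ≤ 1) (hprod : A * B = (1 - w) ^ 2) (hK : 1 / 2 ≤ K) (hK1 : K ≤ 1) :
    2 ≤ A ^ K + B ^ K + w ^ K := by
  have hAK : 0 ≤ A ^ K := rpow_nonneg hA K
  have hBK : 0 ≤ B ^ K := rpow_nonneg hB K
  have bernoulli : ∀ x : ℝ, 0 ≤ x → 1 + (2 * K) * (x - 1) ≤ (x ^ K) ^ 2 := fun x hx => by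
    have h := one_add_mul_self_le_rpow_one_add (s := x - 1) (by linarith)
      (p := 2 * K) (by linarith)
    rwa [add_sub_cancel, mul_comm 2 K, rpow_mul hx, rpow_two, mul_comm K 2] at h
  have hprodK : (1 - w) ^ 2 ≤ A ^ K * B ^ K := by
    rw [← mul_rpow hA hB, hprod]
    exact self_le_rpow_of_le_one (by positivity) (by nlinarith) hK1
  have hwK : w ≤ w ^ K := self_le_rpow_of_le_one hw hw1 hK1
  have hsum : 2 - w ≤ A ^ K + B ^ K := by
    refine le_of_sq_le_sq ?_ (by positivity)
    nlinarith [bernoulli A hA, bernoulli B hB, sq_nonneg w]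
  linarith

/-- A reverse concavity inequality for `x ↦ x ^ K` at two squares. -/
lemma two_mul_add_sq_rpow_le {a b K : ℝ} (hb : 0 ≤ b) (hab : b ≤ a) (hK : 0 < K) (hK1 : K ≤ 1) :
    2 * (a ^ 2 + b ^ 2) ^ K ≤ (2 * a ^ 2) ^ K + (2 * b ^ 2) ^ K + ((a - b) ^ 2) ^ K := by
  have ha : 0 ≤ a := hb.trans hab
  rcases le_total K (1 / 2) with hK2 | hK2
  · have hmono : (a ^ 2 + b ^ 2) ^ K ≤ (2 * a ^ 2) ^ K :=
      rpow_le_rpow (by positivity) (by nlinarith) hK.le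
    have sq_rpow : ∀ x : ℝ, 0 ≤ x → (x ^ 2) ^ K = x ^ (2 * K) := fun x hx => by
      rw [rpow_mul hx, rpow_two]
    have hsq : √2 ^ 2 = 2 := sq_sqrt zero_le_two
    have hsqrt : 1 ≤ √2 := one_le_sqrt.2 one_le_two
    have hsub : (a ^ 2 + b ^ 2) ^ K ≤ (2 * b ^ 2) ^ K + ((a - b) ^ 2) ^ K := by
      calc (a ^ 2 + b ^ 2) ^ K ≤ ((√2 * b + (a - b)) ^ 2) ^ K := by
            refine rpow_le_rpow (by positivity) ?_ hK.le
            have hba : 0 ≤ b * (a - b) := mul_nonneg hb (sub_nonneg.2 hab)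
            have hexp : (√2 * b + (a - b)) ^ 2 =
                √2 ^ 2 * b ^ 2 + 2 * √2 * (b * (a - b)) + (a - b) ^ 2 := by ring
            rw [hexp, hsq]
            nlinarith [mul_nonneg (sub_nonneg.2 hsqrt) hba]
        _ = (√2 * b + (a - b)) ^ (2 * K) :=
            sq_rpow _ (add_nonneg (by positivity) (sub_nonneg.2 hab))
        _ ≤ (√2 * b) ^ (2 * K) + (a - b) ^ (2 * K) :=
            rpow_add_le_add_rpow (by positivity) (sub_nonneg.2 hab) (by linarith) (by linarith)
        _ = (2 * b ^ 2) ^ K + ((a - b) ^ 2) ^ K := by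
            rw [← sq_rpow _ (by positivity), ← sq_rpow _ (sub_nonneg.2 hab), mul_pow, hsq]
    linarith
  · rcases ha.eq_or_lt with rfl | ha
    · obtain rfl : b = 0 := le_antisymm hab hb
      simp [zero_rpow hK.ne']
    have hM : 0 < a ^ 2 + b ^ 2 := by positivity
    have h := two_le_rpow_add_rpow_add_rpow (A := 2 * a ^ 2 / (a ^ 2 + b ^ 2))
      (B := 2 * b ^ 2 / (a ^ 2 + b ^ 2)) (w := (a - b) ^ 2 / (a ^ 2 + b ^ 2))
      (by positivity) (by positivity) (by field_simp) (by positivity)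
      ((div_le_one hM).2 (by nlinarith)) (by field_simp; ring) hK2 hK1
    rwa [div_rpow (by positivity) hM.le, div_rpow (by positivity) hM.le,
      div_rpow (by positivity) hM.le, ← add_div, ← add_div, le_div_iff₀ (by positivity)] at h

/-- Midpoint concavity of `x ↦ x ^ K`, in homogeneous form. -/
lemma two_rpow_mul_rpow_add_rpow_le {x y K : ℝ} (hx : 0 ≤ x) (hy : 0 ≤ y) (hK : 0 ≤ K)
    (hK1 : K ≤ 1) : 2 ^ K * (x ^ K + y ^ K) ≤ 2 * (x + y) ^ K := by
  have h := (concaveOn_rpow hK hK1).2 (Set.mem_Ici.2 (mul_nonneg zero_le_two hx))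
    (Set.mem_Ici.2 (mul_nonneg zero_le_two hy))
    (show (0 : ℝ) ≤ 1 / 2 by norm_num) (show (0 : ℝ) ≤ 1 / 2 by norm_num) (by norm_num)
  have hmid : 1 / 2 * (2 * x) + 1 / 2 * (2 * y) = x + y := by ring
  simp only [smul_eq_mul] at h
  rw [hmid, mul_rpow zero_le_two hx, mul_rpow zero_le_two hy] at h
  linarith

/-- Condition (A) for bifractional Brownian motion with indices `H, K ∈ (0,1)`
(Example (iv) in Section 3 of the paper): with covariance
`R(t,s) = 2^{-K}((t^{2H} + s^{2H})^K - |t-s|^{2HK})`, the incremental variance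
`R(t,t) + R(s,s) - 2R(t,s)` satisfies
`2^{-K}(t-s)^{2HK} ≤ R(t,t) + R(s,s) - 2R(t,s) ≤ 2^{1-K}(t-s)^{2HK}`. -/
theorem bifBm_incremental_variance_two_sided_bound
    (H : ℝ) (hH : H ∈ Set.Ioo (0 : ℝ) 1)
    (K : ℝ) (hK : K ∈ Set.Ioo (0 : ℝ) 1)
    (R : ℝ → ℝ → ℝ)
    (hR : ∀ t s : ℝ, R t s =
      2 ^ (-K) * ((t ^ (2 * H) + s ^ (2 * H)) ^ K - |t - s| ^ (2 * H * K)))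
    (s t : ℝ) (hs : 0 ≤ s) (hst : s ≤ t) :
    2 ^ (-K) * (t - s) ^ (2 * H * K) ≤ R t t + R s s - 2 * R t s ∧
      R t t + R s s - 2 * R t s ≤ 2 ^ (1 - K) * (t - s) ^ (2 * H * K) := by
  obtain ⟨hH0, hH1⟩ := hH
  obtain ⟨hK0, hK1⟩ := hK
  have ht : 0 ≤ t := hs.trans hst
  have hts : 0 ≤ t - s := sub_nonneg.2 hst
  have rpow_two_mul : ∀ x : ℝ, 0 ≤ x → x ^ (2 * H) = (x ^ H) ^ 2 := fun x hx => by
    rw [mul_comm, rpow_mul hx, rpow_two]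
  have hdiag : ∀ x : ℝ, 0 ≤ x → R x x = 2 ^ (-K) * (2 ^ K * (x ^ (2 * H)) ^ K) := fun x hx => by
    rw [hR, sub_self, abs_zero, zero_rpow (by positivity), sub_zero, ← two_mul,
      mul_rpow zero_le_two (by positivity)]
  have hpow : (2 : ℝ) ^ (1 - K) = 2 ^ (-K) * 2 := by
    rw [sub_eq_neg_add, rpow_add two_pos, rpow_one]
  have hc : (0 : ℝ) ≤ 2 ^ (-K) := by positivity
  have hupper := two_rpow_mul_rpow_add_rpow_le (rpow_nonneg ht (2 * H)) (rpow_nonneg hs (2 * H))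
    hK0.le hK1.le
  have hmono : s ^ H ≤ t ^ H := rpow_le_rpow hs hst hH0.le
  have hlower := two_mul_add_sq_rpow_le (rpow_nonneg hs H) hmono hK0 hK1.le
  have hincr : t ^ H - s ^ H ≤ (t - s) ^ H := by
    have h := rpow_add_le_add_rpow hts hs hH0.le hH1.le
    rw [sub_add_cancel] at h
    linarith
  have hdiff : ((t ^ H - s ^ H) ^ 2) ^ K ≤ (t - s) ^ (2 * H * K) := by
    rw [rpow_mul hts, rpow_two_mul _ hts]
    exact rpow_le_rpow (sq_nonneg _) (pow_le_pow_left₀ (sub_nonneg.2 hmono) hincr 2) hK0.le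
  rw [mul_rpow zero_le_two (sq_nonneg _), mul_rpow zero_le_two (sq_nonneg _),
    ← rpow_two_mul _ ht, ← rpow_two_mul _ hs] at hlower
  rw [hdiag t ht, hdiag s hs, hR t s, abs_of_nonneg hts, hpow]
  constructor
  · linarith [mul_le_mul_of_nonneg_left (hlower.trans (add_le_add_right hdiff _)) hc]
  · linarith [mul_le_mul_of_nonneg_left hupper hc]
end

section
/- Let r ∈ [0,1/2), 1/2 < H₂ < 1, H₁ ≥ H₂, D₁, D₂, D₃ > 0 and δ ∈ (0,1). Let K:[0,1]×(0,1]→ℝ be measurable with K(t,s) = 0 for s > t, such that: K is nonnegative and for each s, t ↦ K(t,s) is nondecreasing; |K(t₂,s) − K(t₁,s)| ≤ D₂|t₂−t₁|^{H₂} s^{−r} for all s, t₁, t₂ ∈ (0,1]; K(t,s) ≤ D₃(t−s)^{H₂−1/2} s^{−r} for 0 < s < t ≤ 1; and D₁|t₂−t₁|^{H₁} s^{−r} ≤ |K(t₂,s) − K(t₁,s)| for all 0 < s ≤ t₁ ≤ t₂ ≤ 1. Then there exist constants C₁, C₂ > 0 such that for all s,t ∈ [1−δ,1] with s ≤ t,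 C₁(t−s)^{2H₁} ≤ ∫_0^1 (K(t,u) − K(s,u))² du ≤ C₂(t−s)^{2H₂}. -/
open MeasureTheory Real intervalIntegral

/-- Condition (A) for a Volterra kernel (Example (v) in Section 3 of the paper):
under conditions (B1), (B2) and (B3,a) on the kernel `K`, the incremental
variance `∫_0^1 (K(t,u) - K(s,u))² du` of the Volterra Gaussian process
`G(t) = ∫_0^t K(t,s) dW(s)` admits the two-sided power bound
`C₁ (t-s)^{2H₁} ≤ ∫_0^1 (K(t,u) - K(s,u))² du ≤ C₂ (t-s)^{2H₂}` on `[1-δ,1]`. -/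
theorem volterra_kernel_condition_A
    (r : ℝ) (hr : r ∈ Set.Ico (0 : ℝ) (1 / 2))
    (H₁ H₂ : ℝ) (hH₂ : H₂ ∈ Set.Ioo (1 / 2 : ℝ) 1) (hH₁ : H₂ ≤ H₁)
    (D₁ D₂ D₃ : ℝ) (hD₁ : 0 < D₁) (hD₂ : 0 < D₂) (hD₃ : 0 < D₃)
    (δ : ℝ) (hδ : δ ∈ Set.Ioo (0 : ℝ) 1)
    (K : ℝ → ℝ → ℝ) (hKmeas : Measurable (fun p : ℝ × ℝ => K p.1 p.2))
    (hKvolterra : ∀ t s : ℝ, t < s → K t s = 0)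
    (hKnonneg : ∀ t ∈ Set.Icc (0 : ℝ) 1, ∀ s ∈ Set.Ioc (0 : ℝ) 1, 0 ≤ K t s)
    (hKmono : ∀ s ∈ Set.Ioc (0 : ℝ) 1, MonotoneOn (fun t => K t s) (Set.Icc (0 : ℝ) 1))
    (hB2a : ∀ s ∈ Set.Ioc (0 : ℝ) 1, ∀ t₁ ∈ Set.Ioc (0 : ℝ) 1, ∀ t₂ ∈ Set.Ioc (0 : ℝ) 1,
      |K t₂ s - K t₁ s| ≤ D₂ * |t₂ - t₁| ^ H₂ * s ^ (-r))
    (hB2b : ∀ s t : ℝ, 0 < s → s < t → t ≤ 1 →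
      K t s ≤ D₃ * (t - s) ^ (H₂ - 1 / 2) * s ^ (-r))
    (hB3a : ∀ s t₁ t₂ : ℝ, 0 < s → s ≤ t₁ → t₁ ≤ t₂ → t₂ ≤ 1 →
      D₁ * |t₂ - t₁| ^ H₁ * s ^ (-r) ≤ |K t₂ s - K t₁ s|) :
    ∃ C₁ C₂ : ℝ, 0 < C₁ ∧ 0 < C₂ ∧
      ∀ s ∈ Set.Icc (1 - δ) 1, ∀ t ∈ Set.Icc (1 - δ) 1, s ≤ t →
        C₁ * (t - s) ^ (2 * H₁) ≤ (∫ u in (0 : ℝ)..1, (K t u - K s u) ^ 2) ∧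
        (∫ u in (0 : ℝ)..1, (K t u - K s u) ^ 2) ≤ C₂ * (t - s) ^ (2 * H₂) := by
  obtain ⟨hr0, hr1⟩ := hr
  obtain ⟨hδ0, hδ1⟩ := hδ
  refine ⟨D₁ ^ 2 * (1 - δ), D₂ ^ 2 * (1 / (1 - 2 * r)), by nlinarith [pow_pos hD₁ 2],
    mul_pos (pow_pos hD₂ 2) (one_div_pos.mpr (by linarith)), ?_⟩
  rintro s ⟨hs0, hs1⟩ t ⟨ht0, ht1⟩ hst
  have hh : 0 ≤ t - s := sub_nonneg.mpr hst
  have sq_rpow : ∀ x : ℝ, 0 ≤ x → ∀ a : ℝ, (x ^ a) ^ 2 = x ^ (2 * a) := fun x hx a => by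
    rw [← rpow_natCast, ← rpow_mul hx, mul_comm]; norm_num
  have hupper : ∀ u ∈ Set.Ioc (0 : ℝ) 1,
      (K t u - K s u) ^ 2 ≤ D₂ ^ 2 * (t - s) ^ (2 * H₂) * u ^ (-(2 * r)) := fun u hu => by
    have h := hB2a u hu s ⟨by linarith, hs1⟩ t ⟨by linarith, ht1⟩
    rw [abs_of_nonneg hh] at h
    calc (K t u - K s u) ^ 2 = |K t u - K s u| ^ 2 := (sq_abs _).symm
      _ ≤ (D₂ * (t - s) ^ H₂ * u ^ (-r)) ^ 2 := by gcongr
      _ = _ := by rw [mul_pow, mul_pow, sq_rpow _ hh, sq_rpow _ hu.1.le, mul_neg]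
  have hlower : ∀ u ∈ Set.Ioc (0 : ℝ) (1 - δ),
      D₁ ^ 2 * (t - s) ^ (2 * H₁) ≤ (K t u - K s u) ^ 2 := fun u hu => by
    have h := hB3a u s t hu.1 (hu.2.trans hs0) hst ht1
    rw [abs_of_nonneg hh] at h
    have hone : 1 ≤ u ^ (-r) :=
      one_le_rpow_of_pos_of_le_one_of_nonpos hu.1 (by linarith [hu.2]) (by linarith)
    have hnn : 0 ≤ D₁ * (t - s) ^ H₁ := by positivity
    calc D₁ ^ 2 * (t - s) ^ (2 * H₁) = (D₁ * (t - s) ^ H₁) ^ 2 := by rw [mul_pow, sq_rpow _ hh]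
      _ ≤ |K t u - K s u| ^ 2 := by
        gcongr
        exact (le_mul_of_one_le_right hnn hone).trans h
      _ = _ := sq_abs _
  have hdom : IntervalIntegrable
      (fun u => D₂ ^ 2 * (t - s) ^ (2 * H₂) * u ^ (-(2 * r))) volume 0 1 :=
    (intervalIntegrable_rpow' (by linarith)).const_mul _
  have hmeas : Measurable (fun u => (K t u - K s u) ^ 2) :=
    ((hKmeas.comp measurable_prodMk_left).sub (hKmeas.comp measurable_prodMk_left)).pow_const 2
  have hint : IntervalIntegrable (fun u => (K t u - K s u) ^ 2) volume 0 1 := by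
    refine hdom.mono_fun' hmeas.aestronglyMeasurable ?_
    rw [Set.uIoc_of_le zero_le_one]
    refine (ae_restrict_mem measurableSet_Ioc).mono fun u hu => ?_
    simpa only [norm_of_nonneg (sq_nonneg (K t u - K s u))] using hupper u hu
  constructor
  · calc D₁ ^ 2 * (1 - δ) * (t - s) ^ (2 * H₁)
        = ∫ _ in (0 : ℝ)..(1 - δ), D₁ ^ 2 * (t - s) ^ (2 * H₁) := by
          rw [intervalIntegral.integral_const, smul_eq_mul]; ring
      _ ≤ ∫ u in (0 : ℝ)..(1 - δ), (K t u - K s u) ^ 2 :=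
          integral_mono_on_of_le_Ioo (by linarith) intervalIntegrable_const
            (hint.mono_set (by
              rw [Set.uIcc_of_le (by linarith), Set.uIcc_of_le zero_le_one]
              exact Set.Icc_subset_Icc_right (by linarith)))
            fun u hu => hlower u (Set.Ioo_subset_Ioc_self hu)
      _ ≤ ∫ u in (0 : ℝ)..1, (K t u - K s u) ^ 2 :=
          integral_mono_interval le_rfl (by linarith) (by linarith)
            (Filter.Eventually.of_forall fun u => sq_nonneg _) hint
  · calc (∫ u in (0 : ℝ)..1, (K t u - K s u) ^ 2)
        ≤ ∫ u in (0 : ℝ)..1, D₂ ^ 2 * (t - s) ^ (2 * H₂) * u ^ (-(2 * r)) :=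
          integral_mono_on_of_le_Ioo zero_le_one hint hdom
            fun u hu => hupper u (Set.Ioo_subset_Ioc_self hu)
      _ = D₂ ^ 2 * (1 / (1 - 2 * r)) * (t - s) ^ (2 * H₂) := by
          rw [intervalIntegral.integral_const_mul, integral_rpow (Or.inl (by linarith)),
            one_rpow, zero_rpow (by linarith), sub_zero, neg_add_eq_sub]
          ring
end

section
/- Let H ∈ (1/2,1) and t > 0. Then ∫_0^t ( s^{1/2−H}·t^{H−1/2}·(t−s)^{1/2−H} − (H−1/2)·s^{1/2−H}·∫_s^t u^{H−3/2}(u−s)^{1/2−H} du ) ds = [Γ(3/2−H)² / ((3/2−H)·Γ(2−2H))] · t^{3/2−H}, where Γ denotes the Gamma function. -/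
open MeasureTheory Real intervalIntegral

theorem ofReal_beta_integrand {a b u s : ℝ} (hs : s ∈ Set.Ioc 0 u) :
    ((s ^ (a - 1) * (u - s) ^ (b - 1) : ℝ) : ℂ) =
      (s : ℂ) ^ ((a : ℂ) - 1) * ((u : ℂ) - s) ^ ((b : ℂ) - 1) := by
  rw [Complex.ofReal_mul, Complex.ofReal_cpow hs.1.le, Complex.ofReal_cpow (sub_nonneg.2 hs.2)]
  push_cast
  rfl

theorem integral_rpow_mul_sub_rpow {a b u : ℝ} (ha : 0 < a) (hb : 0 < b) (hu : 0 < u) :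
    ∫ s in (0 : ℝ)..u, s ^ (a - 1) * (u - s) ^ (b - 1) =
      u ^ (a + b - 1) * (Gamma a * Gamma b / Gamma (a + b)) := by
  apply Complex.ofReal_injective
  have h := Complex.betaIntegral_scaled a b hu
  rw [Complex.betaIntegral_eq_Gamma_mul_div _ _ (by simpa) (by simpa)] at h
  rw [← intervalIntegral.integral_ofReal]
  rw [intervalIntegral.integral_congr_ae (g := fun s : ℝ =>
    (s : ℂ) ^ ((a : ℂ) - 1) * ((u : ℂ) - s) ^ ((b : ℂ) - 1)), h]
  · push_cast [Complex.ofReal_cpow hu.le, ← Complex.Gamma_ofReal]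
    rfl
  · refine Filter.Eventually.of_forall fun s hs => ?_
    rw [Set.uIoc_of_le hu.le] at hs
    exact ofReal_beta_integrand hs

theorem integrableOn_rpow_mul_sub_rpow {a b u : ℝ} (ha : 0 < a) (hb : 0 < b) (hu : 0 < u) :
    IntegrableOn (fun s : ℝ => s ^ (a - 1) * (u - s) ^ (b - 1)) (Set.Ioc 0 u) := by
  rw [← intervalIntegrable_iff_integrableOn_Ioc_of_le hu.le]
  refine not_imp_comm.1 intervalIntegral.integral_undef ?_
  rw [integral_rpow_mul_sub_rpow ha hb hu]
  have := Gamma_pos_of_pos ha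
  have := Gamma_pos_of_pos hb
  have := Gamma_pos_of_pos (add_pos ha hb)
  positivity

/-- The integrand of a weighted Beta integral, extended by zero off the triangle `s < u`. -/
noncomputable def triangleKernel (a b c s u : ℝ) : ℝ :=
  (Set.Iio u).indicator (fun s => u ^ c * (s ^ (a - 1) * (u - s) ^ (b - 1))) s

theorem triangleKernel_eq_indicator_Ioi (a b c s : ℝ) :
    triangleKernel a b c s =
      (Set.Ioi s).indicator (fun u => s ^ (a - 1) * (u ^ c * (u - s) ^ (b - 1))) := by
  ext u
  simp only [triangleKernel, Set.indicator_apply, Set.mem_Iio, Set.mem_Ioi]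
  split_ifs <;> ring

theorem triangleKernel_nonneg {a b c s u : ℝ} (hs : 0 ≤ s) (hu : 0 ≤ u) :
    0 ≤ triangleKernel a b c s u :=
  Set.indicator_apply_nonneg fun h =>
    mul_nonneg (rpow_nonneg hu _)
      (mul_nonneg (rpow_nonneg hs _) (rpow_nonneg (sub_nonneg.2 (le_of_lt h)) _))

theorem measurable_uncurry_triangleKernel (a b c : ℝ) :
    Measurable (Function.uncurry (triangleKernel a b c)) := by
  have : Function.uncurry (triangleKernel a b c) =
      {p : ℝ × ℝ | p.1 < p.2}.indicator
        (fun p => p.2 ^ c * (p.1 ^ (a - 1) * (p.2 - p.1) ^ (b - 1))) := by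
    ext p
    simp [Function.uncurry, triangleKernel, Set.indicator_apply]
  rw [this]
  exact Measurable.indicator (by fun_prop) (measurableSet_lt measurable_fst measurable_snd)

theorem Ioc_inter_Iio_of_mem {t u : ℝ} (hu : u ∈ Set.Ioc 0 t) :
    Set.Ioc 0 t ∩ Set.Iio u = Set.Ioo 0 u := by
  ext s
  exact ⟨fun h => ⟨h.1.1, h.2⟩, fun h => ⟨⟨h.1, h.2.le.trans hu.2⟩, h.2⟩⟩

theorem setIntegral_triangleKernel_left {a b : ℝ} (c : ℝ) {t u : ℝ} (ha : 0 < a) (hb : 0 < b)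
    (hu : u ∈ Set.Ioc 0 t) :
    ∫ s in Set.Ioc 0 t, triangleKernel a b c s u =
      u ^ (c + (a + b - 1)) * (Gamma a * Gamma b / Gamma (a + b)) := by
  simp only [triangleKernel]
  rw [setIntegral_indicator measurableSet_Iio, Ioc_inter_Iio_of_mem hu,
    ← integral_Ioc_eq_integral_Ioo, MeasureTheory.integral_const_mul,
    ← intervalIntegral.integral_of_le hu.1.le, integral_rpow_mul_sub_rpow ha hb hu.1,
    rpow_add hu.1, mul_assoc]

theorem setIntegral_triangleKernel_right {a b c t s : ℝ} (hs : s ∈ Set.Ioc 0 t) :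
    ∫ u in Set.Ioc 0 t, triangleKernel a b c s u =
      s ^ (a - 1) * ∫ u in s..t, u ^ c * (u - s) ^ (b - 1) := by
  have h : Set.Ioc 0 t ∩ Set.Ioi s = Set.Ioc s t := by
    ext u
    exact ⟨fun h => ⟨h.2, h.1.2⟩, fun h => ⟨⟨hs.1.trans h.1, h.2⟩, h.1⟩⟩
  rw [triangleKernel_eq_indicator_Ioi, setIntegral_indicator measurableSet_Ioi, h,
    MeasureTheory.integral_const_mul, intervalIntegral.integral_of_le hs.2]

theorem integrable_uncurry_triangleKernel {a b c t : ℝ} (ha : 0 < a) (hb : 0 < b)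
    (hc : 0 < a + b + c) (ht : 0 < t) :
    Integrable (Function.uncurry (triangleKernel a b c))
      ((volume.restrict (Set.Ioc 0 t)).prod (volume.restrict (Set.Ioc 0 t))) := by
  rw [integrable_prod_iff' (measurable_uncurry_triangleKernel a b c).aestronglyMeasurable]
  constructor
  · filter_upwards [ae_restrict_mem measurableSet_Ioc] with u hu
    change IntegrableOn
      ((Set.Iio u).indicator fun s => u ^ c * (s ^ (a - 1) * (u - s) ^ (b - 1))) (Set.Ioc 0 t)
    rw [IntegrableOn, integrable_indicator_iff measurableSet_Iio, IntegrableOn,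
      Measure.restrict_restrict measurableSet_Iio, Set.inter_comm, Ioc_inter_Iio_of_mem hu]
    exact ((integrableOn_rpow_mul_sub_rpow ha hb hu.1).mono_set Set.Ioo_subset_Ioc_self).const_mul _
  · have h : IntegrableOn
        (fun u : ℝ => u ^ (c + (a + b - 1)) * (Gamma a * Gamma b / Gamma (a + b)))
        (Set.Ioc 0 t) := by
      rw [← intervalIntegrable_iff_integrableOn_Ioc_of_le ht.le]
      exact (intervalIntegral.intervalIntegrable_rpow' (by linarith)).mul_const _
    refine Integrable.congr h ?_
    filter_upwards [ae_restrict_mem measurableSet_Ioc] with u hu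
    rw [← setIntegral_triangleKernel_left c ha hb hu]
    refine setIntegral_congr_fun measurableSet_Ioc fun s hs => ?_
    exact (norm_of_nonneg (triangleKernel_nonneg hs.1.le hu.1.le)).symm

theorem intervalIntegrable_rpow_mul_integral {a b c t : ℝ} (ha : 0 < a) (hb : 0 < b)
    (hc : 0 < a + b + c) (ht : 0 < t) :
    IntervalIntegrable (fun s => s ^ (a - 1) * ∫ u in s..t, u ^ c * (u - s) ^ (b - 1))
      volume 0 t := by
  rw [intervalIntegrable_iff_integrableOn_Ioc_of_le ht.le]
  refine Integrable.congr (integrable_uncurry_triangleKernel ha hb hc ht).integral_prod_left ?_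
  filter_upwards [ae_restrict_mem measurableSet_Ioc] with s hs
  exact setIntegral_triangleKernel_right hs

theorem integral_rpow_mul_integral {a b c t : ℝ} (ha : 0 < a) (hb : 0 < b)
    (hc : 0 < a + b + c) (ht : 0 < t) :
    ∫ s in (0 : ℝ)..t, s ^ (a - 1) * ∫ u in s..t, u ^ c * (u - s) ^ (b - 1) =
      Gamma a * Gamma b / Gamma (a + b) * (t ^ (a + b + c) / (a + b + c)) := by
  rw [intervalIntegral.integral_of_le ht.le,
    ← setIntegral_congr_fun measurableSet_Ioc fun s hs => setIntegral_triangleKernel_right hs,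
    integral_integral_swap (integrable_uncurry_triangleKernel ha hb hc ht),
    setIntegral_congr_fun measurableSet_Ioc fun u hu =>
      setIntegral_triangleKernel_left c ha hb hu,
    ← intervalIntegral.integral_of_le ht.le, intervalIntegral.integral_mul_const,
    integral_rpow (Or.inl (by linarith)), show c + (a + b - 1) + 1 = a + b + c by ring,
    zero_rpow hc.ne', sub_zero, mul_comm]

/-- The Beta-function identity from Example 4.2 of the paper: for `H ∈ (1/2,1)`
and `t > 0`,
`∫_0^t ( s^{1/2-H} t^{H-1/2} (t-s)^{1/2-H} - (H-1/2) s^{1/2-H} ∫_s^t u^{H-3/2}(u-s)^{1/2-H} du ) ds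
  = Γ(3/2-H)²/((3/2-H) Γ(2-2H)) · t^{3/2-H}`,
exhibiting the hidden semimartingale structure of the fractional Black–Scholes
model. -/
theorem fBm_kernel_integral_identity
    (H : ℝ) (hH : H ∈ Set.Ioo (1 / 2 : ℝ) 1) (t : ℝ) (ht : 0 < t) :
    ∫ s in (0 : ℝ)..t,
        (s ^ (1 / 2 - H) * t ^ (H - 1 / 2) * (t - s) ^ (1 / 2 - H)
          - (H - 1 / 2) * s ^ (1 / 2 - H) *
            ∫ u in s..t, u ^ (H - 3 / 2) * (u - s) ^ (1 / 2 - H)) =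
      (Real.Gamma (3 / 2 - H) ^ 2 / ((3 / 2 - H) * Real.Gamma (2 - 2 * H))) *
        t ^ (3 / 2 - H) := by
  obtain ⟨h₁, h₂⟩ := hH
  have ha : 0 < 3 / 2 - H := by linarith
  have hc : 0 < 3 / 2 - H + (3 / 2 - H) + (H - 3 / 2) := by linarith
  have hint₁ : IntervalIntegrable
      (fun s : ℝ => s ^ (3 / 2 - H - 1) * (t - s) ^ (3 / 2 - H - 1)) volume 0 t :=
    (intervalIntegrable_iff_integrableOn_Ioc_of_le ht.le).2
      (integrableOn_rpow_mul_sub_rpow ha ha ht)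
  have hint₂ := intervalIntegrable_rpow_mul_integral ha ha hc ht
  have hfirst := integral_rpow_mul_sub_rpow ha ha ht
  have hsecond := integral_rpow_mul_integral ha ha hc ht
  rw [show 3 / 2 - H - 1 = 1 / 2 - H by ring] at hint₁ hint₂ hfirst hsecond
  have hsplit (s : ℝ) :
      s ^ (1 / 2 - H) * t ^ (H - 1 / 2) * (t - s) ^ (1 / 2 - H)
          - (H - 1 / 2) * s ^ (1 / 2 - H) *
            ∫ u in s..t, u ^ (H - 3 / 2) * (u - s) ^ (1 / 2 - H) =
        t ^ (H - 1 / 2) * (s ^ (1 / 2 - H) * (t - s) ^ (1 / 2 - H))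
          - (H - 1 / 2) * (s ^ (1 / 2 - H) *
            ∫ u in s..t, u ^ (H - 3 / 2) * (u - s) ^ (1 / 2 - H)) := by
    ring
  have hGamma : Gamma (3 / 2 - H + (3 / 2 - H)) = (2 - 2 * H) * Gamma (2 - 2 * H) := by
    rw [← Gamma_add_one (by linarith)]
    ring_nf
  have hpow : t ^ (H - 1 / 2) * t ^ (3 / 2 - H + (3 / 2 - H) - 1) = t ^ (3 / 2 - H) := by
    rw [← rpow_add ht]
    ring_nf
  have hGpos : 0 < Gamma (2 - 2 * H) := Gamma_pos_of_pos (by linarith)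
  have hH' : 2 - 2 * H ≠ 0 := by linarith
  simp_rw [hsplit]
  rw [intervalIntegral.integral_sub (hint₁.const_mul _) (hint₂.const_mul _),
    intervalIntegral.integral_const_mul, intervalIntegral.integral_const_mul, hfirst, hsecond,
    ← mul_assoc, hpow, hGamma,
    show 3 / 2 - H + (3 / 2 - H) + (H - 3 / 2) = 3 / 2 - H by ring]
  generalize t ^ (3 / 2 - H) = T
  generalize Gamma (3 / 2 - H) = G
  have ha' := ha.ne'
  have hG' := hGpos.ne'
  generalize Gamma (2 - 2 * H) = D at hG' ⊢
  have h : T - (H - 1 / 2) * (T / (3 / 2 - H)) = (2 - 2 * H) * T / (3 / 2 - H) := by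
    rw [eq_div_iff ha', sub_mul, mul_assoc, div_mul_cancel₀ _ ha']
    ring
  calc _ = G * G / ((2 - 2 * H) * D) * (T - (H - 1 / 2) * (T / (3 / 2 - H))) := by ring
    _ = _ := by
      rw [h, div_mul_div_comm, div_mul_eq_mul_div, div_eq_div_iff (by positivity) (by positivity)]
      ring
end
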